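/- arXiv:2202.02244 — 7 statements merged into one kernel-verified Lean document; each statement's English description precedes it below -/
import Mathlib

section
/- Suppose −π/2 ≤ θ₁ − θ₂ ≤ π/2, s₁ > 0, s₂ > 0, and s₁·s₂ ≥ 4·cos³((θ₁ − θ₂)/3). Then ⟨A, B⟩ is discrete and freely generated by A and B. -/
open Real Complex Matrix

/-- Ping-pong with generators acting as translations on real-valued coordinates: a base point in
the common fundamental domain is moved out of it by every nontrivial reduced word. -/
theorem FreeGroup.exists_le_abs_lift_smul_of_shift {ι G α : Type*} [Group G] [MulAction G α]
    (a : ι → G) (N : Set α) (f : ι → α → ℝ) (c : ι → ℝ) (hc : ∀ i, 0 < c i)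
    (hN : ∀ i, ∀ v, a i • v ∈ N ↔ v ∈ N)
    (hshift : ∀ i, ∀ v ∈ N, f i (a i • v) = f i v + c i)
    (hdisj : ∀ i j, i ≠ j → ∀ v ∈ N, c i / 2 ≤ |f i v| → |f j v| < c j / 2)
    (p : α) (hp : p ∈ N) (hpf : ∀ i, |f i p| < c i / 2) (w : FreeGroup ι) (hw : w ≠ 1) :
    ∃ i, c i / 2 ≤ |f i (FreeGroup.lift a w • p)| := by
  classical
  have key : ∀ L : List (ι × Bool), FreeGroup.IsReduced L →
      FreeGroup.lift a (FreeGroup.mk L) • p ∈ N ∧ ∀ l ∈ L.head?,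
        c l.1 / 2 ≤ cond l.2 1 (-1) * f l.1 (FreeGroup.lift a (FreeGroup.mk L) • p) := by
    intro L
    induction L with
    | nil => intro _; simpa [FreeGroup.lift_mk] using hp
    | cons l L ih =>
      intro hL
      obtain ⟨hv, hhead⟩ := ih (List.IsChain.tail hL)
      have hmul : FreeGroup.lift a (FreeGroup.mk (l :: L)) • p =
          cond l.2 (a l.1) (a l.1)⁻¹ • FreeGroup.lift a (FreeGroup.mk L) • p := by
        simp [FreeGroup.lift_mk, mul_smul]
      have hlast : -(c l.1 / 2) < cond l.2 1 (-1) *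
          f l.1 (FreeGroup.lift a (FreeGroup.mk L) • p) := by
        have hbd : |f l.1 (FreeGroup.lift a (FreeGroup.mk L) • p)| < c l.1 / 2 →
            -(c l.1 / 2) < cond l.2 1 (-1) *
              f l.1 (FreeGroup.lift a (FreeGroup.mk L) • p) := by
          intro h
          rw [abs_lt] at h
          cases l.2 <;> simp only [cond_true, cond_false, one_mul, neg_one_mul] <;> linarith
        match L, hL, hhead, hv, hbd with
        | [], _, _, _, hbd => exact hbd (by simpa [FreeGroup.lift_mk] using hpf l.1)
        | l' :: L', hL, hhead, hv, hbd =>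
          have h' := hhead l' (by simp)
          by_cases hl : l.1 = l'.1
          · have hb := (FreeGroup.isReduced_cons_cons.1 hL).1 hl
            rw [← hl, ← hb] at h'
            have := hc l.1
            linarith
          · refine hbd (hdisj l'.1 l.1 (Ne.symm hl) _ hv (h'.trans ?_))
            cases l'.2 <;> simp [le_abs_self, neg_le_abs]
      rw [hmul]
      generalize FreeGroup.lift a (FreeGroup.mk L) • p = v at hv hlast
      obtain ⟨i, b⟩ := l
      cases b with
      | true =>
        simp only [cond_true, one_mul] at hlast ⊢
        refine ⟨(hN i v).2 hv, ?_⟩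
        simp only [List.head?_cons, Option.mem_some_iff, forall_eq', cond_true, one_mul]
        rw [hshift i v hv]
        linarith
      | false =>
        simp only [cond_false] at hlast ⊢
        have hv' : (a i)⁻¹ • v ∈ N := by rw [← hN i, smul_inv_smul]; exact hv
        refine ⟨hv', ?_⟩
        simp only [List.head?_cons, Option.mem_some_iff, forall_eq', cond_false]
        have := hshift i _ hv'
        rw [smul_inv_smul] at this
        linarith
  obtain ⟨-, h⟩ := key w.toWord FreeGroup.isReduced_toWord
  rw [FreeGroup.mk_toWord] at h
  match hL : w.toWord with
  | [] => exact absurd (FreeGroup.toWord_eq_nil_iff.1 hL) hw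
  | l :: L =>
    refine ⟨l.1, (h l (by simp [hL])).trans ?_⟩
    cases l.2 <;> simp [le_abs_self, neg_le_abs]

/-- A finitely generated group moving a base point out of a common fundamental domain is discrete
and free. -/
theorem FreeGroup.discrete_and_injective_of_shift {ι G α : Type*} [Finite ι] [Group G]
    [TopologicalSpace G] [IsTopologicalGroup G] [MulAction G α]
    (a : ι → G) (N : Set α) (f : ι → α → ℝ) (c : ι → ℝ) (hc : ∀ i, 0 < c i)
    (hN : ∀ i, ∀ v, a i • v ∈ N ↔ v ∈ N)
    (hshift : ∀ i, ∀ v ∈ N, f i (a i • v) = f i v + c i)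
    (hdisj : ∀ i j, i ≠ j → ∀ v ∈ N, c i / 2 ≤ |f i v| → |f j v| < c j / 2)
    (p : α) (hp : p ∈ N) (hpf : ∀ i, |f i p| < c i / 2)
    (hcont : ∀ i, ContinuousAt (fun g : G => f i (g • p)) 1) :
    DiscreteTopology ↥(Subgroup.closure (Set.range a)) ∧
      Function.Injective (FreeGroup.lift a) := by
  have key := FreeGroup.exists_le_abs_lift_smul_of_shift a N f c hc hN hshift hdisj p hp hpf
  refine ⟨?_, ?_⟩
  · rw [← FreeGroup.range_lift_eq_closure, discreteTopology_iff_isOpen_singleton_one,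
      isOpen_singleton_iff_nhds_eq_pure]
    refine le_antisymm ?_ (pure_le_nhds 1)
    rw [Filter.le_pure_iff]
    have hev : ∀ᶠ g : G in nhds 1, ∀ i, |f i (g • p)| < c i / 2 := by
      rw [Filter.eventually_all]
      intro i
      refine (hcont i).abs.eventually_lt continuousAt_const ?_
      simpa using hpf i
    have hsub : Filter.Tendsto (fun g : (FreeGroup.lift a).range => (g : G)) (nhds 1) (nhds 1) :=
      continuous_subtype_val.tendsto' _ _ rfl
    filter_upwards [hsub.eventually hev] with g hg
    obtain ⟨_, w, rfl⟩ := g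
    by_contra hne
    have hw : w ≠ 1 := by
      rintro rfl
      exact hne (Subtype.ext (_root_.map_one _))
    obtain ⟨i, hi⟩ := key w hw
    exact absurd (hg i) (not_lt.2 hi)
  · rw [injective_iff_map_eq_one]
    intro w hw
    by_contra hne
    obtain ⟨i, hi⟩ := key w hne
    rw [hw, one_smul] at hi
    exact absurd (hpf i) (not_lt.2 hi)

theorem abs_one_add_cos_mul_cos_le (d u : ℝ) (hd : |d| ≤ π / 6) :
    |(1 + Real.cos u) * Real.cos (u + 3 * d)| ≤ 2 * Real.cos d ^ 3 := by
  obtain ⟨τ, rfl⟩ : ∃ τ, u = τ - 2 * d := ⟨u + 2 * d, by ring⟩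
  have hC : √3 / 2 ≤ Real.cos d := by
    rw [← Real.cos_pi_div_six, ← Real.cos_abs d]
    exact Real.cos_le_cos_of_nonneg_of_le_pi (abs_nonneg d) (by linarith [Real.pi_pos]) hd
  have h3 : 0 ≤ Real.cos (3 * d) := by
    rw [abs_le] at hd
    exact Real.cos_nonneg_of_neg_pi_div_two_le_of_le (by linarith) (by linarith)
  have hS := Real.sin_sq_add_cos_sq d
  have hs := Real.sin_sq_add_cos_sq τ
  have hdbl : Real.cos (τ - 2 * d) = Real.cos τ * (2 * Real.cos d ^ 2 - 1) +
      Real.sin τ * (2 * Real.sin d * Real.cos d) := by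
    rw [Real.cos_sub, Real.cos_two_mul, Real.sin_two_mul]
  have hsum : Real.cos (τ - 2 * d + 3 * d) =
      Real.cos τ * Real.cos d - Real.sin τ * Real.sin d := by
    rw [← Real.cos_add]; ring_nf
  rw [Real.cos_three_mul] at h3
  rw [hdbl, hsum]
  have hC0 : 0 < Real.cos d := lt_of_lt_of_le (by positivity) hC
  have hCS : 3 * Real.sin d ^ 2 ≤ Real.cos d ^ 2 := by
    have : (√3 / 2) ^ 2 ≤ Real.cos d ^ 2 := by gcongr
    rw [div_pow, Real.sq_sqrt (by norm_num)] at this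
    linarith
  have hc1 := Real.cos_le_one τ
  have hc2 := Real.neg_one_le_cos τ
  generalize Real.cos d = C at *
  generalize Real.sin d = S at *
  generalize Real.cos τ = c at *
  generalize Real.sin τ = s at *
  have hSs : 3 * (S * s) ^ 2 ≤ C ^ 2 * (1 - c ^ 2) := by
    have : s ^ 2 = 1 - c ^ 2 := by linarith
    rw [mul_pow, this, ← mul_assoc]
    exact mul_le_mul_of_nonneg_right hCS (by nlinarith)
  have e1 : -(C * (2 + c)) ≤ S * s := by
    refine (abs_le.1 (abs_le_of_sq_le_sq ?_ (by nlinarith))).1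
    nlinarith [mul_nonneg (sq_nonneg C) (sq_nonneg (c + 1)), sq_nonneg C]
  have e2 : (1 - c) * (S * s) ≤ C * (c ^ 2 + c + 1) := by
    refine (abs_le.1 (abs_le_of_sq_le_sq ?_ (mul_nonneg hC0.le (by nlinarith)))).2
    have h := mul_le_mul_of_nonneg_left hSs (sq_nonneg (1 - c))
    have h' : 0 ≤ C ^ 2 * ((2 * c + 1) ^ 2 * (c ^ 2 + 2)) := by positivity
    nlinarith [h, h']
  have hS2 : S ^ 2 = 1 - C ^ 2 := by linarith
  have hs2 : s ^ 2 = 1 - c ^ 2 := by linarith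
  have expand : (1 + (c * (2 * C ^ 2 - 1) + s * (2 * S * C))) * (c * C - s * S) =
      2 * C ^ 3 - (1 - c) * (C * (2 + c) + S * s) := by
    linear_combination (-2 * C * s ^ 2) * hS2 + (-2 * C * (1 - C ^ 2)) * hs2
  rw [expand, abs_le]
  constructor
  · nlinarith
  · nlinarith [mul_nonneg (sub_nonneg.2 hc1) (neg_le_iff_add_nonneg'.1 e1)]

/-- The product of three cosines whose angles sum to `δ` up to sign is at most `cos (δ / 3) ^ 3`. -/
theorem abs_cos_mul_cos_mul_cos_le (x y δ : ℝ) (hδ : |δ| ≤ π / 2) :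
    |Real.cos x * Real.cos y * Real.cos (x - y + δ)| ≤ Real.cos (δ / 3) ^ 3 := by
  have hd : |δ / 3| ≤ π / 6 := by
    rw [abs_div, abs_of_pos (by norm_num : (0 : ℝ) < 3)]; linarith
  have h1 := abs_one_add_cos_mul_cos_le (δ / 3) (x - y) hd
  have h2 := abs_one_add_cos_mul_cos_le (δ / 3) (x - y + π) hd
  rw [show x - y + π + 3 * (δ / 3) = x - y + δ + π by ring, Real.cos_add_pi, Real.cos_add_pi] at h2
  rw [show x - y + 3 * (δ / 3) = x - y + δ by ring] at h1
  rw [abs_mul] at h1 h2 ⊢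
  rw [abs_neg] at h2
  have hprod : 2 * (Real.cos x * Real.cos y) = Real.cos (x - y) + Real.cos (x + y) := by
    rw [Real.cos_sub, Real.cos_add]; ring
  have hA := abs_nonneg (Real.cos (x - y + δ))
  have hp := Real.cos_le_one (x + y)
  have hm := Real.neg_one_le_cos (x + y)
  rcases le_total 0 (Real.cos x * Real.cos y) with h | h
  · rw [abs_of_nonneg h]
    have := mul_le_mul_of_nonneg_right (le_abs_self (1 + Real.cos (x - y))) hA
    nlinarith
  · rw [abs_of_nonpos h]
    have := mul_le_mul_of_nonneg_right (le_abs_self (1 + -Real.cos (x - y))) hA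
    nlinarith

/-- The Hermitian form of signature `(2, 1)` given by the antidiagonal matrix. -/
def siegelForm (v : Fin 3 → ℂ) : ℝ :=
  2 * (v 0 * (starRingEnd ℂ) (v 2)).re + Complex.normSq (v 1)

theorem re_exp_mul_div (θ : ℝ) (z w : ℂ) :
    (Complex.exp (-(θ * Complex.I)) * (z / w)).re = ‖z‖ / ‖w‖ * Real.cos (z.arg - w.arg - θ) := by
  have h : Complex.exp (-(θ * Complex.I)) * (z / w) =
      ((‖z‖ / ‖w‖ : ℝ) : ℂ) * Complex.exp ((z.arg - w.arg - θ : ℝ) * Complex.I) := by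
    conv_lhs => rw [← Complex.norm_mul_exp_arg_mul_I z, ← Complex.norm_mul_exp_arg_mul_I w]
    push_cast
    rw [mul_div_mul_comm, ← Complex.exp_sub, mul_left_comm, ← Complex.exp_add]
    ring_nf
  rw [h, Complex.re_ofReal_mul, Complex.exp_ofReal_mul_I_re]

theorem re_mul_conj_eq (z w : ℂ) :
    (z * (starRingEnd ℂ) w).re = ‖z‖ * ‖w‖ * Real.cos (z.arg - w.arg) := by
  rw [Complex.mul_re, Complex.conj_re, Complex.conj_im, Real.cos_sub]
  conv_lhs => rw [← Complex.norm_mul_cos_arg z, ← Complex.norm_mul_sin_arg z,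
    ← Complex.norm_mul_cos_arg w, ← Complex.norm_mul_sin_arg w]
  ring

theorem ne_zero_of_siegelForm_neg {v : Fin 3 → ℂ} (hv : siegelForm v < 0) :
    v 0 ≠ 0 ∧ v 2 ≠ 0 := by
  constructor <;> intro h <;> simp only [siegelForm, h] at hv <;>
    simp only [zero_mul, map_zero, mul_zero, Complex.zero_re, zero_add] at hv <;>
    exact absurd hv (not_lt.2 (Complex.normSq_nonneg _))

/-- The complements of the two fundamental domains (bounded by fans) are disjoint. -/
theorem fans_disjoint {s₁ s₂ θ₁ θ₂ : ℝ} (hs₁ : 0 < s₁) (hs₂ : 0 < s₂)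
    (hθ : |θ₁ - θ₂| ≤ π / 2) (hineq : 4 * Real.cos ((θ₁ - θ₂) / 3) ^ 3 ≤ s₁ * s₂)
    {v : Fin 3 → ℂ} (hv : siegelForm v < 0)
    (h₁ : √2 * s₁ / 2 ≤ |(Complex.exp (-(θ₁ * Complex.I)) * (v 1 / v 2)).re|)
    (h₂ : √2 * s₂ / 2 ≤ |(Complex.exp (-(θ₂ * Complex.I)) * (v 1 / v 0)).re|) : False := by
  obtain ⟨h0, h2⟩ := ne_zero_of_siegelForm_neg hv
  rw [siegelForm, re_mul_conj_eq, Complex.normSq_eq_norm_sq] at hv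
  rw [re_exp_mul_div] at h₁ h₂
  have htrig := abs_cos_mul_cos_mul_cos_le ((v 1).arg - (v 2).arg - θ₁)
    ((v 1).arg - (v 0).arg - θ₂) (θ₁ - θ₂) hθ
  rw [show (v 1).arg - (v 2).arg - θ₁ - ((v 1).arg - (v 0).arg - θ₂) + (θ₁ - θ₂) =
    (v 0).arg - (v 2).arg by ring] at htrig
  have hr0 := norm_pos_iff.2 h0
  have hr2 := norm_pos_iff.2 h2
  have hprod := mul_le_mul h₁ h₂ (by positivity) (abs_nonneg _)
  generalize Real.cos ((v 1).arg - (v 2).arg - θ₁) = a at *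
  generalize Real.cos ((v 1).arg - (v 0).arg - θ₂) = b at *
  generalize Real.cos ((v 0).arg - (v 2).arg) = c at *
  generalize ‖v 0‖ = r0 at *
  generalize ‖v 1‖ = r1 at *
  generalize ‖v 2‖ = r2 at *
  generalize Real.cos ((θ₁ - θ₂) / 3) ^ 3 = K at *
  have hsq : √2 * √2 = 2 := Real.mul_self_sqrt (by norm_num)
  have hlow : s₁ * s₂ / 2 * (r0 * r2) ≤ r1 ^ 2 * |a * b| := by
    rw [← abs_mul, show r1 / r2 * a * (r1 / r0 * b) = r1 ^ 2 / (r0 * r2) * (a * b) by field_simp,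
      abs_mul, abs_of_nonneg (by positivity : 0 ≤ r1 ^ 2 / (r0 * r2)),
      div_mul_eq_mul_div (r1 ^ 2), le_div_iff₀ (by positivity)] at hprod
    calc s₁ * s₂ / 2 * (r0 * r2) = √2 * s₁ / 2 * (√2 * s₂ / 2) * (r0 * r2) := by
          linear_combination (-(s₁ * s₂ * r0 * r2) / 4) * hsq
      _ ≤ _ := hprod
  have hab : 0 < |a * b| := by
    by_contra hcon
    have h0' : |a * b| = 0 := le_antisymm (not_lt.1 hcon) (abs_nonneg _)
    rw [h0', mul_zero] at hlow
    exact absurd hlow (not_le.2 (by positivity))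
  rw [abs_mul] at htrig
  have hrr : 0 < r0 * r2 := by positivity
  have hup : r1 ^ 2 < 2 * (r0 * r2) * |c| := by
    have := mul_le_mul_of_nonneg_left (neg_abs_le c) hrr.le
    nlinarith
  have h3 := mul_lt_mul_of_pos_right hup hab
  have h4 := mul_le_mul_of_nonneg_left htrig hrr.le
  have h5 := mul_le_mul_of_nonneg_left hineq hrr.le
  nlinarith

/-- The tautological action of the general linear group on column vectors. -/
@[reducible] def mulVecAction (n R : Type*) [Fintype n] [DecidableEq n] [CommRing R] :
    MulAction (GL n R) (n → R) where
  smul g v := (g : Matrix n n R) *ᵥ v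
  one_smul v := Matrix.one_mulVec v
  mul_smul g h v := (Matrix.mulVec_mulVec v (g : Matrix n n R) (h : Matrix n n R)).symm

theorem siegelForm_upper (ζ : ℂ) (t : ℝ) (v : Fin 3 → ℂ) :
    siegelForm (!![1, -(√2 : ℂ) * (starRingEnd ℂ) ζ, -(Complex.normSq ζ : ℂ) + t * Complex.I;
      0, 1, (√2 : ℂ) * ζ; 0, 0, 1] *ᵥ v) = siegelForm v := by
  have hsq : √2 * √2 = 2 := Real.mul_self_sqrt (by norm_num)
  simp [siegelForm, Matrix.mulVec, dotProduct, Fin.sum_univ_three, Complex.normSq_apply]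
  linear_combination (ζ.re ^ 2 + ζ.im ^ 2) * ((v 2).re ^ 2 + (v 2).im ^ 2) * hsq

theorem siegelForm_lower (ζ : ℂ) (t : ℝ) (v : Fin 3 → ℂ) :
    siegelForm (!![1, 0, 0; (√2 : ℂ) * ζ, 1, 0;
      -(Complex.normSq ζ : ℂ) + t * Complex.I, -(√2 : ℂ) * (starRingEnd ℂ) ζ, 1] *ᵥ v) =
      siegelForm v := by
  have hsq : √2 * √2 = 2 := Real.mul_self_sqrt (by norm_num)
  simp [siegelForm, Matrix.mulVec, dotProduct, Fin.sum_univ_three, Complex.normSq_apply]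
  linear_combination (ζ.re ^ 2 + ζ.im ^ 2) * ((v 0).re ^ 2 + (v 0).im ^ 2) * hsq

theorem re_exp_mul_add_div (θ s : ℝ) {z w : ℂ} (hw : w ≠ 0) :
    (Complex.exp (-(θ * Complex.I)) *
      ((z + (√2 : ℂ) * s * Complex.exp (θ * Complex.I) * w) / w)).re =
      (Complex.exp (-(θ * Complex.I)) * (z / w)).re + √2 * s := by
  have h : Complex.exp (-(θ * Complex.I)) *
      ((z + (√2 : ℂ) * s * Complex.exp (θ * Complex.I) * w) / w) =
      Complex.exp (-(θ * Complex.I)) * (z / w) + ((√2 * s : ℝ) : ℂ) := by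
    rw [add_div, mul_div_cancel_right₀ _ hw, mul_add, mul_left_comm _ ((√2 : ℂ) * s),
      ← Complex.exp_add, neg_add_cancel, Complex.exp_zero]
    push_cast
    ring
  rw [h, Complex.add_re, Complex.ofReal_re]

theorem conj_polar (s θ : ℝ) :
    (starRingEnd ℂ) (s * Complex.exp (θ * Complex.I)) = s * Complex.exp (-(θ * Complex.I)) := by
  rw [map_mul, Complex.conj_ofReal, ← Complex.exp_conj, map_mul, Complex.conj_ofReal,
    Complex.conj_I, mul_neg]

theorem normSq_polar (s θ : ℝ) : Complex.normSq (s * Complex.exp (θ * Complex.I)) = s ^ 2 := by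
  rw [Complex.normSq_eq_norm_sq, norm_mul, Complex.norm_exp_ofReal_mul_I, mul_one,
    Complex.norm_real, Real.norm_eq_abs, sq_abs]

theorem discrete_free_fans
    (s₁ s₂ t₁ t₂ θ₁ θ₂ : ℝ)
    (hs₁ : 0 < s₁) (hs₂ : 0 < s₂)
    (h₁ : (s₁, t₁) ≠ (0, 0)) (h₂ : (s₂, t₂) ≠ (0, 0))
    (hθ : -(π / 2) ≤ θ₁ - θ₂ ∧ θ₁ - θ₂ ≤ π / 2)
    (A B : GL (Fin 3) ℂ)
    (hA : (A : Matrix (Fin 3) (Fin 3) ℂ) =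
      !![1, -(Real.sqrt 2 : ℂ) * s₁ * Complex.exp (-(θ₁ * Complex.I)), -(s₁ : ℂ)^2 + t₁ * Complex.I;
         0, 1, (Real.sqrt 2 : ℂ) * s₁ * Complex.exp (θ₁ * Complex.I);
         0, 0, 1])
    (hB : (B : Matrix (Fin 3) (Fin 3) ℂ) =
      !![1, 0, 0;
         (Real.sqrt 2 : ℂ) * s₂ * Complex.exp (θ₂ * Complex.I), 1, 0;
         -(s₂ : ℂ)^2 + t₂ * Complex.I, -(Real.sqrt 2 : ℂ) * s₂ * Complex.exp (-(θ₂ * Complex.I)), 1])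
    (hineq : s₁ * s₂ ≥ 4 * Real.cos ((θ₁ - θ₂) / 3) ^ 3) :
    DiscreteTopology ↥(Subgroup.closure ({A, B} : Set (GL (Fin 3) ℂ))) ∧
    Function.Injective ⇑(FreeGroup.lift (fun i : Fin 2 => if i = 0 then A else B)) := by
  let _ := mulVecAction (Fin 3) ℂ
  have smul_def : ∀ (g : GL (Fin 3) ℂ) (v : Fin 3 → ℂ),
      g • v = (g : Matrix (Fin 3) (Fin 3) ℂ) *ᵥ v := fun _ _ => rfl
  have hθ' : |θ₁ - θ₂| ≤ π / 2 := abs_le.2 hθ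
  have hrange : Set.range (fun i : Fin 2 => if i = 0 then A else B) = {A, B} := by
    ext g
    simp [Fin.exists_fin_two, eq_comm]
  have hAform : ∀ v, siegelForm (A • v) = siegelForm v := fun v => by
    rw [smul_def, hA, ← siegelForm_upper (s₁ * Complex.exp (θ₁ * Complex.I)) t₁ v,
      conj_polar, normSq_polar]
    simp only [mul_assoc, Complex.ofReal_pow]
  have hBform : ∀ v, siegelForm (B • v) = siegelForm v := fun v => by
    rw [smul_def, hB, ← siegelForm_lower (s₂ * Complex.exp (θ₂ * Complex.I)) t₂ v,
      conj_polar, normSq_polar]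
    simp only [mul_assoc, Complex.ofReal_pow]
  have hA1 : ∀ v : Fin 3 → ℂ, (A • v) 1 =
      v 1 + (√2 : ℂ) * s₁ * Complex.exp (θ₁ * Complex.I) * v 2 := fun v => by
    rw [smul_def, hA]; simp [Matrix.mulVec, dotProduct, Fin.sum_univ_three]
  have hA2 : ∀ v : Fin 3 → ℂ, (A • v) 2 = v 2 := fun v => by
    rw [smul_def, hA]; simp [Matrix.mulVec, dotProduct, Fin.sum_univ_three]
  have hB1 : ∀ v : Fin 3 → ℂ, (B • v) 1 =
      v 1 + (√2 : ℂ) * s₂ * Complex.exp (θ₂ * Complex.I) * v 0 := fun v => by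
    rw [smul_def, hB]; simp [Matrix.mulVec, dotProduct, Fin.sum_univ_three, add_comm]
  have hB0 : ∀ v : Fin 3 → ℂ, (B • v) 0 = v 0 := fun v => by
    rw [smul_def, hB]; simp [Matrix.mulVec, dotProduct, Fin.sum_univ_three]
  rw [← hrange]
  refine FreeGroup.discrete_and_injective_of_shift _ {v | siegelForm v < 0}
    ![fun v => (Complex.exp (-(θ₁ * Complex.I)) * (v 1 / v 2)).re,
      fun v => (Complex.exp (-(θ₂ * Complex.I)) * (v 1 / v 0)).re]
    ![√2 * s₁, √2 * s₂] ?_ ?_ ?_ ?_ ![-1, 0, 1] ?_ ?_ ?_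
  · simp [Fin.forall_fin_two, hs₁, hs₂]
  · simp [Fin.forall_fin_two, hAform, hBform]
  · rw [Fin.forall_fin_two]
    constructor <;> intro v hv <;> obtain ⟨h0, h2⟩ := ne_zero_of_siegelForm_neg hv
    · simpa [hA1, hA2] using re_exp_mul_add_div θ₁ s₁ (z := v 1) h2
    · simpa [hB1, hB0] using re_exp_mul_add_div θ₂ s₂ (z := v 1) h0
  · rw [Fin.forall_fin_two, Fin.forall_fin_two, Fin.forall_fin_two]
    refine ⟨⟨fun h => absurd rfl h, fun _ v hv h => ?_⟩,
      ⟨fun _ v hv h => ?_, fun h => absurd rfl h⟩⟩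
    · exact not_le.1 fun h' => fans_disjoint hs₁ hs₂ hθ' hineq hv h h'
    · exact not_le.1 fun h' => fans_disjoint hs₁ hs₂ hθ' hineq hv h' h
  · simp [siegelForm]
  · simp [Fin.forall_fin_two, hs₁, hs₂]
  · have hcoord : ∀ k, ContinuousAt (fun g : GL (Fin 3) ℂ => (g • ![-1, 0, 1] : Fin 3 → ℂ) k) 1 :=
      fun k => ((continuous_apply k).comp
        (Units.continuous_val.matrix_mulVec continuous_const)).continuousAt
    rw [Fin.forall_fin_two]
    constructor
    · refine Complex.continuous_re.continuousAt.comp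
        (continuousAt_const.mul ((hcoord 1).div (hcoord 2) ?_))
      simp
    · refine Complex.continuous_re.continuousAt.comp
        (continuousAt_const.mul ((hcoord 1).div (hcoord 0) ?_))
      simp
end

section
/- If |t₁|^{1/2}·|t₂|^{1/2} ≥ 2, then ⟨A, B⟩ is discrete and freely generated by A and B. -/
open Real Complex Matrix

/-- A ping-pong principle keyed by the first letter of a reduced word: if the sets `C l` are
entered by the letters themselves and are respected by reduced left multiplication, then every
nontrivial element of the free group lands in some `C l`. -/
theorem FreeGroup.exists_lift_mem_of_ne_one {α G : Type*} [DecidableEq α] [Group G] (f : α → G)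
    (C : α × Bool → Set G) (hletter : ∀ l, (bif l.2 then f l.1 else (f l.1)⁻¹) ∈ C l)
    (hmul : ∀ l l', (l.1 = l'.1 → l.2 = l'.2) → ∀ g ∈ C l',
      (bif l.2 then f l.1 else (f l.1)⁻¹) * g ∈ C l)
    {w : FreeGroup α} (hw : w ≠ 1) : ∃ l, FreeGroup.lift f w ∈ C l := by
  have key : ∀ (L : List (α × Bool)) (l : α × Bool), FreeGroup.IsReduced (l :: L) →
      FreeGroup.lift f (FreeGroup.mk (l :: L)) ∈ C l := by
    intro L
    induction L with
    | nil => intro l _; simpa [FreeGroup.lift_mk] using hletter l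
    | cons l' L ih =>
      intro l hl
      rw [FreeGroup.isReduced_cons_cons] at hl
      have h := hmul l l' hl.1 _ (ih l' hl.2)
      rw [FreeGroup.lift_mk] at h ⊢
      rwa [List.map_cons, List.prod_cons]
  have hne : w.toWord ≠ [] := mt FreeGroup.toWord_eq_nil_iff.mp hw
  obtain ⟨l, L, hL⟩ := List.exists_cons_of_ne_nil hne
  refine ⟨l, ?_⟩
  rw [← FreeGroup.mk_toWord (x := w), hL]
  exact key L l (hL ▸ FreeGroup.isReduced_toWord)

theorem sq_le_four_mul_add_sq {a b : ℝ} (h : 4 * a ^ 2 ≤ b ^ 2) :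
    b ^ 2 ≤ 4 * (a + b) ^ 2 ∧ 0 ≤ b * (a + b) := by
  have h' : |2 * a| ≤ |b| := sq_le_sq.mp (by linarith)
  rcases abs_cases b with ⟨hb, hb'⟩ | ⟨hb, hb'⟩ <;> rw [hb, abs_le] at h' <;>
    constructor <;> nlinarith

theorem four_mul_sq_le_add_mul_sq {k p r : ℝ} (hk : 16 ≤ k ^ 2) (h : r ^ 2 ≤ 4 * p ^ 2) :
    4 * p ^ 2 ≤ (r + k * p) ^ 2 ∧ 0 ≤ k * p * (r + k * p) := by
  obtain ⟨h₁, h₂⟩ := sq_le_four_mul_add_sq (a := r) (b := k * p) (by nlinarith [sq_nonneg p])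
  exact ⟨by nlinarith [sq_nonneg p], h₂⟩

/-- The sign of the exponent of a letter of the free group. -/
def letterSign (b : Bool) : ℝ := if b then 1 else -1

theorem letterSign_sq (b : Bool) : letterSign b ^ 2 = 1 := by
  cases b <;> norm_num [letterSign]

/-- The cone attached to a letter: the letters `(0, b)` act by `p ↦ p ± r` and the letters `(1, b)`
by `r ↦ r ± k * p`. -/
def letterCone (k : ℝ) (l : Fin 2 × Bool) (p r : ℝ) : Prop :=
  if l.1 = 0 then r ^ 2 ≤ 4 * p ^ 2 ∧ 0 ≤ letterSign l.2 * r * p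
  else 4 * p ^ 2 ≤ r ^ 2 ∧ 0 ≤ letterSign l.2 * k * p * r

theorem letterCone_zero {k p r : ℝ} {b : Bool} {l : Fin 2 × Bool}
    (hl : 0 = l.1 → b = l.2) (h : letterCone k l p r) :
    letterCone k (0, b) (p + letterSign b * r) r := by
  obtain ⟨i, b'⟩ := l
  have hs := letterSign_sq b
  have hr : (letterSign b * r) ^ 2 = r ^ 2 := by rw [mul_pow, hs, one_mul]
  fin_cases i
  · obtain rfl : b = b' := hl rfl
    obtain ⟨h₁, h₂⟩ : r ^ 2 ≤ 4 * p ^ 2 ∧ 0 ≤ letterSign b * r * p := by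
      simpa [letterCone] using h
    simp only [letterCone, if_true]
    constructor <;> nlinarith [sq_nonneg r]
  · obtain ⟨h₁, -⟩ : 4 * p ^ 2 ≤ r ^ 2 ∧ _ := by simpa [letterCone] using h
    have := sq_le_four_mul_add_sq (h₁.trans_eq hr.symm)
    rw [hr] at this
    simpa only [letterCone, if_true] using this

theorem letterCone_one {k p r : ℝ} (hk : 16 ≤ k ^ 2) {b : Bool} {l : Fin 2 × Bool}
    (hl : 1 = l.1 → b = l.2) (h : letterCone k l p r) :
    letterCone k (1, b) p (r + letterSign b * k * p) := by
  obtain ⟨i, b'⟩ := l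
  have hs : (letterSign b * k) ^ 2 = k ^ 2 := by rw [mul_pow, letterSign_sq, one_mul]
  simp only [letterCone, one_ne_zero, if_false]
  fin_cases i
  · obtain ⟨h₁, -⟩ : r ^ 2 ≤ 4 * p ^ 2 ∧ _ := by simpa [letterCone] using h
    exact four_mul_sq_le_add_mul_sq (hk.trans_eq hs.symm) h₁
  · obtain rfl : b = b' := hl rfl
    obtain ⟨h₁, h₂⟩ : 4 * p ^ 2 ≤ r ^ 2 ∧ 0 ≤ letterSign b * k * p * r := by
      simpa [letterCone] using h
    constructor <;> nlinarith [sq_nonneg (letterSign b * k * p)]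

/-- The vectors of `ℂ³` whose coordinates `v 0` and `t * I * v 2` are real and lie in the cone
attached to the letter `l`. -/
def vectorCone (t k : ℝ) (l : Fin 2 × Bool) : Set (Fin 3 → ℂ) :=
  {v | ∃ p r : ℝ, v 0 = p ∧ t * I * v 2 = r ∧ letterCone k l p r}

section

variable {t₁ t₂ : ℝ} {A B : GL (Fin 3) ℂ}

theorem coe_inv_upper
    (hA : (A : Matrix (Fin 3) (Fin 3) ℂ) = !![1, 0, (t₁ : ℂ) * I; 0, 1, 0; 0, 0, 1]) :
    ((A⁻¹ : GL (Fin 3) ℂ) : Matrix (Fin 3) (Fin 3) ℂ) =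
      !![1, 0, -((t₁ : ℂ) * I); 0, 1, 0; 0, 0, 1] := by
  rw [Units.inv_eq_of_mul_eq_one_right]
  rw [hA]
  ext i j
  fin_cases i <;> fin_cases j <;> simp [Matrix.mul_apply, Fin.sum_univ_three]

theorem coe_inv_lower
    (hB : (B : Matrix (Fin 3) (Fin 3) ℂ) = !![1, 0, 0; 0, 1, 0; (t₂ : ℂ) * I, 0, 1]) :
    ((B⁻¹ : GL (Fin 3) ℂ) : Matrix (Fin 3) (Fin 3) ℂ) =
      !![1, 0, 0; 0, 1, 0; -((t₂ : ℂ) * I), 0, 1] := by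
  rw [Units.inv_eq_of_mul_eq_one_right]
  rw [hB]
  ext i j
  fin_cases i <;> fin_cases j <;> simp [Matrix.mul_apply, Fin.sum_univ_three]

theorem letter_mulVec_mem_vectorCone
    (hA : (A : Matrix (Fin 3) (Fin 3) ℂ) = !![1, 0, (t₁ : ℂ) * I; 0, 1, 0; 0, 0, 1])
    (hB : (B : Matrix (Fin 3) (Fin 3) ℂ) = !![1, 0, 0; 0, 1, 0; (t₂ : ℂ) * I, 0, 1])
    (hk : 16 ≤ (-(t₁ * t₂)) ^ 2) {l l' : Fin 2 × Bool} (hl : l.1 = l'.1 → l.2 = l'.2)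
    {v : Fin 3 → ℂ} (hv : v ∈ vectorCone t₁ (-(t₁ * t₂)) l') :
    ((bif l.2 then (if l.1 = 0 then A else B) else (if l.1 = 0 then A else B)⁻¹ : GL (Fin 3) ℂ) :
      Matrix (Fin 3) (Fin 3) ℂ) *ᵥ v ∈ vectorCone t₁ (-(t₁ * t₂)) l := by
  obtain ⟨p, r, hp, hr, h⟩ := hv
  obtain ⟨i, b⟩ := l
  fin_cases i
  · refine ⟨_, _, ?_, ?_, letterCone_zero hl h⟩
    · cases b <;>
        simp [hA, coe_inv_upper hA, Matrix.mulVec, dotProduct, Fin.sum_univ_three, letterSign, hp,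
          hr]
    · cases b <;>
        simp [hA, coe_inv_upper hA, Matrix.mulVec, dotProduct, Fin.sum_univ_three, hr]
  · refine ⟨_, _, ?_, ?_, letterCone_one hk hl h⟩
    · cases b <;>
        simp [hB, coe_inv_lower hB, Matrix.mulVec, dotProduct, Fin.sum_univ_three, hp]
    · cases b <;>
        simp [hB, coe_inv_lower hB, Matrix.mulVec, dotProduct, Fin.sum_univ_three, letterSign,
          hp, mul_add, hr]
      · linear_combination -(t₁ * t₂ * p : ℂ) * I_sq
      · linear_combination (t₁ * t₂ * p : ℂ) * I_sq

theorem exists_compatible_vectorCone_zero (t k : ℝ) (l : Fin 2 × Bool) :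
    ∃ l' : Fin 2 × Bool, (l.1 = l'.1 → l.2 = l'.2) ∧ ![1, 0, 0] ∈ vectorCone t k l' :=
  ⟨(0, l.2), fun _ => rfl, 1, 0, by simp, by simp, by simp [letterCone]⟩

theorem exists_compatible_vectorCone_two {t : ℝ} (ht : t ≠ 0) (k : ℝ) (l : Fin 2 × Bool) :
    ∃ l' : Fin 2 × Bool, (l.1 = l'.1 → l.2 = l'.2) ∧
      ![0, 0, ((t : ℂ) * I)⁻¹] ∈ vectorCone t k l' := by
  refine ⟨(1, l.2), fun _ => rfl, 0, 1, by simp, ?_, by simp [letterCone]⟩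
  have : (t : ℂ) * I ≠ 0 := mul_ne_zero (by exact_mod_cast ht) I_ne_zero
  simpa using mul_inv_cancel₀ this

/-- The bounds on the entries of a matrix which fail for every nontrivial reduced word. -/
def IsNearOne (t : ℝ) (M : Matrix (Fin 3) (Fin 3) ℂ) : Prop :=
  ‖(2 : ℂ) * (M 0 2 * ((t : ℂ) * I)⁻¹)‖ < ‖M 2 2‖ ∧ ‖(t : ℂ) * I * M 2 0‖ < ‖(2 : ℂ) * M 0 0‖

theorem not_isNearOne {t k : ℝ} (ht : t ≠ 0) {l : Fin 2 × Bool} {M : Matrix (Fin 3) (Fin 3) ℂ}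
    (h₀ : M *ᵥ ![1, 0, 0] ∈ vectorCone t k l)
    (h₂ : M *ᵥ ![0, 0, ((t : ℂ) * I)⁻¹] ∈ vectorCone t k l) : ¬ IsNearOne t M := by
  have hne : (t : ℂ) * I ≠ 0 := mul_ne_zero (by exact_mod_cast ht) I_ne_zero
  rintro ⟨hn₂, hn₀⟩
  obtain ⟨i, b⟩ := l
  fin_cases i
  · obtain ⟨p, r, hp, hr, h⟩ := h₂
    have hp' : M 0 2 * ((t : ℂ) * I)⁻¹ = p := by
      simpa only [Matrix.mulVec, dotProduct, Fin.sum_univ_three, Matrix.cons_val, mul_zero,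
        zero_add] using hp
    have hr' : M 2 2 = r := by
      rw [← hr]
      simp only [Matrix.mulVec, dotProduct, Fin.sum_univ_three, Matrix.cons_val, mul_zero, zero_add]
      rw [mul_comm, mul_assoc, inv_mul_cancel₀ hne, mul_one]
    rw [hp', hr', norm_mul, norm_real, norm_real, Complex.norm_ofNat, ← abs_two, norm_eq_abs,
      norm_eq_abs, ← abs_mul, ← sq_lt_sq] at hn₂
    obtain ⟨h', -⟩ : r ^ 2 ≤ 4 * p ^ 2 ∧ _ := by simpa [letterCone] using h
    linarith
  · obtain ⟨p, r, hp, hr, h⟩ := h₀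
    have hp' : M 0 0 = p := by simpa [Matrix.mulVec, dotProduct, Fin.sum_univ_three] using hp
    have hr' : (t : ℂ) * I * M 2 0 = r := by
      simpa [Matrix.mulVec, dotProduct, Fin.sum_univ_three] using hr
    rw [hp', hr', norm_mul, norm_real, norm_real, Complex.norm_ofNat, ← abs_two, norm_eq_abs,
      norm_eq_abs, ← abs_mul, ← sq_lt_sq] at hn₀
    obtain ⟨h', -⟩ : 4 * p ^ 2 ≤ r ^ 2 ∧ _ := by simpa [letterCone] using h
    linarith

theorem isNearOne_one (t : ℝ) : IsNearOne t 1 := by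
  simp [IsNearOne]

theorem isOpen_isNearOne (t : ℝ) : IsOpen {M | IsNearOne t M} := by
  unfold IsNearOne
  have h₁ : IsOpen {M : Matrix (Fin 3) (Fin 3) ℂ |
      ‖(2 : ℂ) * (M 0 2 * ((t : ℂ) * I)⁻¹)‖ < ‖M 2 2‖} :=
    isOpen_lt (by fun_prop) (by fun_prop)
  have h₂ : IsOpen {M : Matrix (Fin 3) (Fin 3) ℂ | ‖(t : ℂ) * I * M 2 0‖ < ‖(2 : ℂ) * M 0 0‖} :=
    isOpen_lt (by fun_prop) (by fun_prop)
  exact h₁.inter h₂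

theorem not_isNearOne_lift (ht₁ : t₁ ≠ 0)
    (hA : (A : Matrix (Fin 3) (Fin 3) ℂ) = !![1, 0, (t₁ : ℂ) * I; 0, 1, 0; 0, 0, 1])
    (hB : (B : Matrix (Fin 3) (Fin 3) ℂ) = !![1, 0, 0; 0, 1, 0; (t₂ : ℂ) * I, 0, 1])
    (hk : 16 ≤ (-(t₁ * t₂)) ^ 2) {w : FreeGroup (Fin 2)} (hw : w ≠ 1) :
    ¬ IsNearOne t₁ (FreeGroup.lift (fun i : Fin 2 => if i = 0 then A else B) w) := by
  let C (l : Fin 2 × Bool) : Set (GL (Fin 3) ℂ) :=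
    {g | (g : Matrix (Fin 3) (Fin 3) ℂ) *ᵥ ![1, 0, 0] ∈ vectorCone t₁ (-(t₁ * t₂)) l ∧
      (g : Matrix (Fin 3) (Fin 3) ℂ) *ᵥ ![0, 0, ((t₁ : ℂ) * I)⁻¹] ∈
        vectorCone t₁ (-(t₁ * t₂)) l}
  suffices h : ∃ l, FreeGroup.lift (fun i : Fin 2 => if i = 0 then A else B) w ∈ C l by
    obtain ⟨l, h₀, h₂⟩ := h
    exact not_isNearOne ht₁ h₀ h₂
  refine FreeGroup.exists_lift_mem_of_ne_one _ C ?_ ?_ hw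
  · intro l
    obtain ⟨l₀, hl₀, hv₀⟩ := exists_compatible_vectorCone_zero t₁ (-(t₁ * t₂)) l
    obtain ⟨l₂, hl₂, hv₂⟩ := exists_compatible_vectorCone_two ht₁ (-(t₁ * t₂)) l
    exact ⟨letter_mulVec_mem_vectorCone hA hB hk hl₀ hv₀,
      letter_mulVec_mem_vectorCone hA hB hk hl₂ hv₂⟩
  · rintro l l' hl g ⟨h₀, h₂⟩
    simp only [C, Set.mem_ofPred_eq, Units.val_mul, ← Matrix.mulVec_mulVec]
    exact ⟨letter_mulVec_mem_vectorCone hA hB hk hl h₀,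
      letter_mulVec_mem_vectorCone hA hB hk hl h₂⟩

end

theorem discrete_free_vertical_translations
    (t₁ t₂ : ℝ) (ht₁ : t₁ ≠ 0) (ht₂ : t₂ ≠ 0)
    (A B : GL (Fin 3) ℂ)
    (hA : (A : Matrix (Fin 3) (Fin 3) ℂ) =
      !![1, 0, (t₁ : ℂ) * Complex.I;
         0, 1, 0;
         0, 0, 1])
    (hB : (B : Matrix (Fin 3) (Fin 3) ℂ) =
      !![1, 0, 0;
         0, 1, 0;
         (t₂ : ℂ) * Complex.I, 0, 1])
    (hineq : |t₁| ^ ((1:ℝ)/2) * |t₂| ^ ((1:ℝ)/2) ≥ 2) :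
    DiscreteTopology ↥(Subgroup.closure ({A, B} : Set (GL (Fin 3) ℂ))) ∧
    Function.Injective ⇑(FreeGroup.lift (fun i : Fin 2 => if i = 0 then A else B)) := by
  have hk : 16 ≤ (-(t₁ * t₂)) ^ 2 := by
    rw [← Real.sqrt_eq_rpow, ← Real.sqrt_eq_rpow, ← Real.sqrt_mul (abs_nonneg _), ← abs_mul,
      ge_iff_le, Real.le_sqrt' two_pos] at hineq
    rw [neg_sq, ← sq_abs]
    nlinarith
  constructor
  · apply discreteTopology_of_isOpen_singleton_one
    have hrange : Set.range (fun i : Fin 2 => if i = 0 then A else B) = {A, B} := by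
      ext g
      simp [Fin.exists_fin_two, eq_comm]
    have hopen : IsOpen {g : Subgroup.closure ({A, B} : Set (GL (Fin 3) ℂ)) |
        IsNearOne t₁ (g : GL (Fin 3) ℂ)} :=
      (isOpen_isNearOne t₁).preimage (Units.continuous_val.comp continuous_subtype_val)
    convert hopen using 1
    ext ⟨g, hg⟩
    rw [Set.mem_singleton_iff, Set.mem_ofPred_eq]
    constructor
    · intro h
      rw [h]
      exact isNearOne_one t₁
    · intro h
      rw [← hrange, ← FreeGroup.range_lift_eq_closure] at hg
      obtain ⟨w, rfl⟩ := hg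
      by_contra hne
      refine not_isNearOne_lift ht₁ hA hB hk (w := w) ?_ h
      rintro rfl
      exact hne (Subtype.ext (map_one _))
  · rw [injective_iff_map_eq_one]
    intro w hw
    by_contra hne
    apply not_isNearOne_lift ht₁ hA hB hk hne
    rw [hw]
    exact isNearOne_one t₁
end

section
/- For every θ ∈ [−π/2, π/2] one has 4·cos³(θ/3) ≥ 4·cos²(θ/2), with equality if and only if θ = 0. -/
open Real

theorem cos_cube_sub_cos_sq (θ : ℝ) :
    4 * Real.cos (θ / 3) ^ 3 - 4 * Real.cos (θ / 2) ^ 2 =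
      2 * (1 - Real.cos (θ / 3)) * (2 * Real.cos (θ / 3) ^ 2 + 2 * Real.cos (θ / 3) - 1) := by
  have h2 := Real.cos_sq (θ / 2)
  have h3 := Real.cos_three_mul (θ / 3)
  rw [mul_div_cancel₀ θ (two_ne_zero)] at h2
  rw [mul_div_cancel₀ θ (three_ne_zero)] at h3
  rw [h2, h3]
  ring

theorem cos_cube_ge_cos_sq (θ : ℝ) (hθ : θ ∈ Set.Icc (-(π / 2)) (π / 2)) :
    4 * Real.cos (θ / 3) ^ 3 ≥ 4 * Real.cos (θ / 2) ^ 2 ∧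
    (4 * Real.cos (θ / 3) ^ 3 = 4 * Real.cos (θ / 2) ^ 2 ↔ θ = 0) := by
  obtain ⟨hl, hu⟩ := hθ
  have hpi := Real.pi_pos
  have hc : 1 / 2 < Real.cos (θ / 3) := by
    rw [← Real.cos_abs, ← Real.cos_pi_div_three]
    refine Real.cos_lt_cos_of_nonneg_of_le_pi (abs_nonneg _) (by linarith) ?_
    rw [abs_lt]
    constructor <;> linarith
  have hq : 0 < 2 * Real.cos (θ / 3) ^ 2 + 2 * Real.cos (θ / 3) - 1 := by nlinarith
  have hone : 0 ≤ 1 - Real.cos (θ / 3) := sub_nonneg.mpr (Real.cos_le_one _)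
  have hfac := cos_cube_sub_cos_sq θ
  refine ⟨?_, fun h => ?_, ?_⟩
  · have : 0 ≤ 2 * (1 - Real.cos (θ / 3)) *
        (2 * Real.cos (θ / 3) ^ 2 + 2 * Real.cos (θ / 3) - 1) := by positivity
    linarith
  · rw [sub_eq_zero.mpr h, eq_comm, mul_eq_zero, or_iff_left hq.ne'] at hfac
    have h0 := (Real.cos_eq_one_iff_of_lt_of_lt (x := θ / 3) (by linarith) (by linarith)).mp
      (by linarith)
    linarith
  · rintro rfl
    simp
end

section
/- Let α ∈ [0, π/2] and define f_α : [0, π/2] → ℝ by f_α(θ) = sin^{1/2}(α)·cos^{1/2}(θ) + cos^{1/2}(α)·sin^{1/2}(θ). Then for every θ ∈ [0, π/2] one has f_α(θ) ≤ (sin^{2/3}(α) + cos^{2/3}(α))^{3/4}, and there exists θ₀ ∈ [0, π/2] for which equality holds. -/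
open Real

/-- Hölder's inequality with exponents `4/3` and `4` for two terms. -/
lemma cube_mul_add_cube_mul_le {a b x y : ℝ} (ha : 0 ≤ a) (hb : 0 ≤ b) (hx : 0 ≤ x) (hy : 0 ≤ y)
    (hxy : x ^ 4 + y ^ 4 = 1) :
    a ^ 3 * x + b ^ 3 * y ≤ (a ^ 4 + b ^ 4) ^ ((3 : ℝ) / 4) := by
  have hpq : (4 / 3 : ℝ).HolderConjugate 4 := by
    rw [Real.holderConjugate_iff]
    norm_num
  have h := Real.inner_le_Lp_mul_Lq Finset.univ ![a ^ 3, b ^ 3] ![x, y] hpq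
  have hcube : ∀ t : ℝ, 0 ≤ t → (t ^ 3) ^ ((4 : ℝ) / 3) = t ^ 4 := fun t ht => by
    rw [← Real.rpow_natCast_mul ht, ← Real.rpow_natCast]
    norm_num
  have hfour : ∀ t : ℝ, t ^ (4 : ℝ) = t ^ 4 := fun t => by
    exact_mod_cast Real.rpow_natCast t 4
  simpa [Fin.sum_univ_two, abs_of_nonneg, ha, hb, hx, hy, hcube, hfour, hxy] using h

/-- A point of the closed first quadrant of the unit circle is `(cos θ, sin θ)` with
`θ ∈ [0, π / 2]`. -/
lemma exists_cos_sin_eq_of_nonneg {x y : ℝ} (hx : 0 ≤ x) (hy : 0 ≤ y) (hxy : x ^ 2 + y ^ 2 = 1) :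
    ∃ θ ∈ Set.Icc (0 : ℝ) (π / 2), cos θ = x ∧ sin θ = y := by
  refine ⟨arccos x, ⟨arccos_nonneg x, arccos_le_pi_div_two.2 hx⟩,
    cos_arccos (by linarith) (by nlinarith), ?_⟩
  rw [sin_arccos, ← hxy, add_sub_cancel_left, sqrt_sq hy]

lemma rpow_half_eq_pow_three {t : ℝ} (ht : 0 ≤ t) :
    t ^ ((1 : ℝ) / 2) = (t ^ ((1 : ℝ) / 6)) ^ 3 := by
  rw [← Real.rpow_mul_natCast ht]
  norm_num

lemma rpow_two_thirds_eq_pow_four {t : ℝ} (ht : 0 ≤ t) :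
    t ^ ((2 : ℝ) / 3) = (t ^ ((1 : ℝ) / 6)) ^ 4 := by
  rw [← Real.rpow_mul_natCast ht]
  norm_num

lemma rpow_half_pow_four {t : ℝ} (ht : 0 ≤ t) : (t ^ ((1 : ℝ) / 2)) ^ 4 = t ^ 2 := by
  rw [← Real.rpow_mul_natCast ht, ← Real.rpow_natCast]
  norm_num

lemma sq_rpow_half {t : ℝ} (ht : 0 ≤ t) : (t ^ 2) ^ ((1 : ℝ) / 2) = t := by
  rw [← Real.sqrt_eq_rpow, Real.sqrt_sq ht]

theorem trig_half_power_max (α : ℝ) (hα : α ∈ Set.Icc 0 (π / 2)) :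
    (∀ θ ∈ Set.Icc (0 : ℝ) (π / 2),
      (Real.sin α) ^ ((1:ℝ)/2) * (Real.cos θ) ^ ((1:ℝ)/2)
        + (Real.cos α) ^ ((1:ℝ)/2) * (Real.sin θ) ^ ((1:ℝ)/2) ≤
      ((Real.sin α) ^ ((2:ℝ)/3) + (Real.cos α) ^ ((2:ℝ)/3)) ^ ((3:ℝ)/4)) ∧
    (∃ θ₀ ∈ Set.Icc (0 : ℝ) (π / 2),
      (Real.sin α) ^ ((1:ℝ)/2) * (Real.cos θ₀) ^ ((1:ℝ)/2)
        + (Real.cos α) ^ ((1:ℝ)/2) * (Real.sin θ₀) ^ ((1:ℝ)/2) =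
      ((Real.sin α) ^ ((2:ℝ)/3) + (Real.cos α) ^ ((2:ℝ)/3)) ^ ((3:ℝ)/4)) := by
  have sin_nonneg' : ∀ θ ∈ Set.Icc (0 : ℝ) (π / 2), 0 ≤ sin θ := fun θ hθ =>
    sin_nonneg_of_nonneg_of_le_pi hθ.1 (by linarith [hθ.2, pi_pos])
  have cos_nonneg' : ∀ θ ∈ Set.Icc (0 : ℝ) (π / 2), 0 ≤ cos θ := fun θ hθ =>
    cos_nonneg_of_neg_pi_div_two_le_of_le (by linarith [hθ.1, pi_pos]) hθ.2
  have hs := sin_nonneg' α hα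
  have hc := cos_nonneg' α hα
  rw [rpow_half_eq_pow_three hs, rpow_half_eq_pow_three hc, rpow_two_thirds_eq_pow_four hs,
    rpow_two_thirds_eq_pow_four hc]
  have ha : 0 ≤ sin α ^ ((1 : ℝ) / 6) := by positivity
  have hb : 0 ≤ cos α ^ ((1 : ℝ) / 6) := by positivity
  have hpos : 0 < (sin α ^ ((1 : ℝ) / 6)) ^ 4 + (cos α ^ ((1 : ℝ) / 6)) ^ 4 := by
    rcases hs.eq_or_lt with h | h
    · have : 0 < cos α := hc.lt_of_ne fun h' => by
        simpa [← h, ← h'] using sin_sq_add_cos_sq α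
      positivity
    · positivity
  generalize sin α ^ ((1 : ℝ) / 6) = a at *
  generalize cos α ^ ((1 : ℝ) / 6) = b at *
  refine ⟨fun θ hθ => ?_, ?_⟩
  · have h₁ := cos_nonneg' θ hθ
    have h₂ := sin_nonneg' θ hθ
    refine cube_mul_add_cube_mul_le ha hb (by positivity) (by positivity) ?_
    rw [rpow_half_pow_four h₁, rpow_half_pow_four h₂, cos_sq_add_sin_sq]
  · obtain ⟨d, hd, hd4⟩ : ∃ d : ℝ, 0 < d ∧ d ^ 4 = a ^ 4 + b ^ 4 :=
      ⟨(a ^ 4 + b ^ 4) ^ ((1 : ℝ) / 4), by positivity, by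
        rw [← Real.rpow_mul_natCast hpos.le]
        norm_num⟩
    obtain ⟨θ, hθ, hcos, hsin⟩ := exists_cos_sin_eq_of_nonneg
      (sq_nonneg (a / d)) (sq_nonneg (b / d)) (by
        field_simp
        linarith)
    refine ⟨θ, hθ, ?_⟩
    have hd3 : (d ^ 4) ^ ((3 : ℝ) / 4) = d ^ 3 := by
      rw [← Real.rpow_natCast_mul hd.le, ← Real.rpow_natCast]
      norm_num
    rw [hcos, hsin, sq_rpow_half (by positivity), sq_rpow_half (by positivity), ← hd4, hd3]
    field_simp
    linarith
end

section
/- Let k ∈ ℝ with k ≠ 0 and let (a, b) ∈ ℝ². Set D = (k² + a²)² + (b − 2ka)², x = (−k(k² + a²) + a(b − 2ka))/D and y = (−a(k² + a²) − k(b − 2ka))/D. Then y² − 4k·x·(x² + y²) − 4k²·(x² + y²)² = ((a(k² + a²) − k(b − 2ka))/D)²; in particular y² − 4k·x·(x² + y²) − 4k²·(x² + y²)² ≥ 0. -/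
theorem fan_projection_in_cardioid (k a b D x y : ℝ) (hk : k ≠ 0)
    (hD : D = (k^2 + a^2)^2 + (b - 2*k*a)^2)
    (hx : x = (-k * (k^2 + a^2) + a * (b - 2*k*a)) / D)
    (hy : y = (-a * (k^2 + a^2) - k * (b - 2*k*a)) / D) :
    y^2 - 4 * k * x * (x^2 + y^2) - 4 * k^2 * (x^2 + y^2)^2 =
      ((a * (k^2 + a^2) - k * (b - 2*k*a)) / D)^2 ∧
    0 ≤ y^2 - 4 * k * x * (x^2 + y^2) - 4 * k^2 * (x^2 + y^2)^2 := by
  have hD0 : D ≠ 0 := by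
    rw [hD]
    positivity
  have hr : x^2 + y^2 = (k^2 + a^2) / D := by
    rw [hx, hy]
    field_simp
    rw [hD]
    ring
  have h : y^2 - 4 * k * x * (x^2 + y^2) - 4 * k^2 * (x^2 + y^2)^2 =
      ((a * (k^2 + a^2) - k * (b - 2*k*a)) / D)^2 := by
    rw [hr, hx, hy]
    field_simp
    ring
  exact ⟨h, h ▸ sq_nonneg _⟩
end

section
/- Let φ ∈ [−π/2, π/2]. Then for every θ ∈ ℝ one has (1 − cos θ)·|cos(θ − φ)|/2 ≤ cos³(φ/3) and (1 + cos θ)·|cos(θ − φ)|/2 ≤ cos³(φ/3); moreover equality holds in the first inequality at θ = 2φ/3 + π and in the second at θ = 2φ/3. -/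
open Real

theorem one_add_cos_mul_cos_sub_le {β : ℝ} (hβ : 1 / 2 ≤ Real.cos β) (θ : ℝ) :
    (1 + Real.cos θ) * Real.cos (θ - 3 * β) / 2 ≤ Real.cos β ^ 3 := by
  obtain ⟨s, rfl⟩ : ∃ s, θ = s + 2 * β := ⟨θ - 2 * β, by ring⟩
  have hsub : s + 2 * β - 3 * β = s - β := by ring
  have hfac : 0 ≤ (1 - Real.cos s) * (2 * Real.cos β + Real.cos (s + β)) :=
    mul_nonneg (by linarith [Real.cos_le_one s])
      (by linarith [Real.neg_one_le_cos (s + β)])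
  rw [hsub, Real.cos_add s (2 * β), Real.cos_sub, Real.cos_two_mul, Real.sin_two_mul]
  rw [Real.cos_add] at hfac
  have key : (1 - Real.cos s) *
        (2 * Real.cos β + (Real.cos s * Real.cos β - Real.sin s * Real.sin β)) =
      2 * Real.cos β ^ 3 - (1 + (Real.cos s * (2 * Real.cos β ^ 2 - 1) -
        Real.sin s * (2 * Real.sin β * Real.cos β))) *
        (Real.cos s * Real.cos β + Real.sin s * Real.sin β) := by
    have h₁ := Real.sin_sq_add_cos_sq s
    have h₂ := Real.sin_sq_add_cos_sq β
    grind
  linarith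

theorem one_add_cos_mul_abs_cos_sub_le {β : ℝ} (hβ : |β| ≤ π / 6) (θ : ℝ) :
    (1 + Real.cos θ) * |Real.cos (θ - 3 * β)| / 2 ≤ Real.cos β ^ 3 := by
  have hπ := Real.pi_pos
  have half_le {x : ℝ} (hx : |x| ≤ π / 3) : 1 / 2 ≤ Real.cos x := by
    rw [← Real.cos_pi_div_three, ← Real.cos_abs x]
    exact Real.cos_le_cos_of_nonneg_of_le_pi (abs_nonneg x) (by linarith) hx
  have neg_bound {γ : ℝ} (h₁ : |γ| ≤ π / 3) (h₂ : |β| ≤ |γ|)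
      (h₃ : Real.cos (θ - 3 * γ) = -Real.cos (θ - 3 * β)) :
      (1 + Real.cos θ) * -Real.cos (θ - 3 * β) / 2 ≤ Real.cos β ^ 3 := by
    rw [← h₃]
    have hγ := half_le h₁
    refine (one_add_cos_mul_cos_sub_le hγ θ).trans (pow_le_pow_left₀ (by linarith) ?_ 3)
    rw [← Real.cos_abs γ, ← Real.cos_abs β]
    exact Real.cos_le_cos_of_nonneg_of_le_pi (abs_nonneg β) (by linarith) h₂
  rcases abs_cases (Real.cos (θ - 3 * β)) with ⟨h, -⟩ | ⟨h, -⟩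
  · rw [h]
    exact one_add_cos_mul_cos_sub_le (half_le (by linarith)) θ
  · rw [h]
    rcases le_total 0 β with h0 | h0
    · rw [abs_of_nonneg h0] at hβ
      have hγ : |β - π / 3| = π / 3 - β := by
        rw [abs_of_nonpos (by linarith)]; ring
      refine neg_bound (γ := β - π / 3) (by linarith)
        (by rw [hγ, abs_of_nonneg h0]; linarith) ?_
      rw [← Real.cos_add_pi]
      ring_nf
    · rw [abs_of_nonpos h0] at hβ
      have hγ : |β + π / 3| = β + π / 3 := abs_of_nonneg (by linarith)
      refine neg_bound (γ := β + π / 3) (by linarith)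
        (by rw [hγ, abs_of_nonpos h0]; linarith) ?_
      rw [← Real.cos_sub_pi]
      ring_nf

theorem cardioid_in_strip (φ : ℝ) (hφ : φ ∈ Set.Icc (-(π / 2)) (π / 2)) :
    (∀ θ : ℝ, (1 - Real.cos θ) * |Real.cos (θ - φ)| / 2 ≤ Real.cos (φ / 3) ^ 3) ∧
    (∀ θ : ℝ, (1 + Real.cos θ) * |Real.cos (θ - φ)| / 2 ≤ Real.cos (φ / 3) ^ 3) ∧
    (1 - Real.cos (2*φ/3 + π)) * |Real.cos ((2*φ/3 + π) - φ)| / 2 = Real.cos (φ / 3) ^ 3 ∧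
    (1 + Real.cos (2*φ/3)) * |Real.cos ((2*φ/3) - φ)| / 2 = Real.cos (φ / 3) ^ 3 := by
  obtain ⟨hl, hu⟩ := hφ
  have hplus (θ : ℝ) :
      (1 + Real.cos θ) * |Real.cos (θ - φ)| / 2 ≤ Real.cos (φ / 3) ^ 3 := by
    have h := one_add_cos_mul_abs_cos_sub_le (β := φ / 3)
      (abs_le.2 ⟨by linarith, by linarith⟩) θ
    rwa [mul_div_cancel₀ φ (three_ne_zero' ℝ)] at h
  have hshift (θ : ℝ) : (1 - Real.cos (θ + π)) * |Real.cos (θ + π - φ)| / 2 =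
      (1 + Real.cos θ) * |Real.cos (θ - φ)| / 2 := by
    rw [add_sub_right_comm, Real.cos_add_pi, Real.cos_add_pi, abs_neg, sub_neg_eq_add]
  have heq : (1 + Real.cos (2*φ/3)) * |Real.cos ((2*φ/3) - φ)| / 2 =
      Real.cos (φ / 3) ^ 3 := by
    have hcos : 0 ≤ Real.cos (φ / 3) :=
      Real.cos_nonneg_of_mem_Icc ⟨by linarith, by linarith⟩
    rw [show 2 * φ / 3 - φ = -(φ / 3) by ring, Real.cos_neg, abs_of_nonneg hcos,
      mul_div_assoc 2 φ 3, Real.cos_two_mul]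
    ring
  refine ⟨fun θ => ?_, hplus, (hshift _).trans heq, heq⟩
  have h := hshift (θ - π)
  rw [sub_add_cancel] at h
  exact h.trans_le (hplus _)
end

section
/- Let r₂ > 0, α₂ ∈ [0, π/2] and θ₂ ∈ ℝ. Set s₂ = r₂·√(sin 2α₂) and t₂ = r₂²·cos 2α₂ (so that −s₂² + i t₂ = i·r₂²·exp(2i α₂)), let c = (sin^{2/3}(α₂) + cos^{2/3}(α₂))^{1/2}, and let φ₂ ∈ [0, π/2] be defined by cos φ₂ = sin^{1/3}(α₂)/c and sin φ₂ = cos^{1/3}(α₂)/c. Set d_B = r₂^{−1}·(√(2·cos φ₂·sin α₂) + √(2·sin φ₂·cos α₂)). Let B ∈ GL(3, ℂ) be the matrix B = [[1, 0, 0], [√2·s₂·exp(i θ₂), 1, 0], [−s₂² + i t₂, −√2·s₂·exp(−i θ₂), 1]], and let 𝐩₊ = (−d_B²·exp(i(α₂ − φ₂)), d_B·√(2·cos(φ₂ − α₂))·exp(i(2α₂ − 2φ₂ + θ₂)), 1)ᵀ and 𝐩₋ = (−d_B²·exp(i(φ₂ − α₂)), −d_B·√(2·cos(φ₂ − α₂))·exp(i(2φ₂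 − 2α₂ + θ₂)), 1)ᵀ in ℂ³. Then B·𝐩₊ = exp(i(2α₂ − 2φ₂))·𝐩₋. -/
open Real Complex Matrix

/-- A nonnegative real is the cube of its real cube root, and its `2/3`-power is the square of
the cube root. -/
lemma rpow_third_cube_and_sq {x : ℝ} (hx : 0 ≤ x) :
    (x ^ ((1:ℝ)/3)) ^ 3 = x ∧ (x ^ ((1:ℝ)/3)) ^ 2 = x ^ ((2:ℝ)/3) := by
  constructor <;> rw [← Real.rpow_natCast, ← Real.rpow_mul hx] <;> norm_num

/-- The real identities behind the action of `B`: with `a`, `b` the cube roots of `sin α` and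
`cos α`, they express the products of `d`, `s`, `t` through the angle `α - φ`. -/
lemma real_relations {r α s t c φ d a b : ℝ} (hr : 0 < r) (ha : 0 ≤ a) (hb : 0 ≤ b)
    (hS : a ^ 3 = Real.sin α) (hC : b ^ 3 = Real.cos α) (hc0 : 0 < c) (hc2 : c ^ 2 = a ^ 2 + b ^ 2)
    (hs : s = r * Real.sqrt (Real.sin (2 * α))) (ht : t = r ^ 2 * Real.cos (2 * α))
    (hcos : Real.cos φ = a / c) (hsin : Real.sin φ = b / c)
    (hd : d = r⁻¹ * (Real.sqrt (2 * Real.cos φ * Real.sin α)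
      + Real.sqrt (2 * Real.sin φ * Real.cos α))) :
    Real.sqrt (2 * Real.cos (φ - α)) ^ 2 = 2 * Real.cos (α - φ) ∧
    Real.sqrt 2 * s * d = Real.sqrt (2 * Real.cos (φ - α)) * (2 * Real.cos (α - φ)) ∧
    s ^ 2 * d ^ 2 = 4 * Real.cos (α - φ) ^ 3 ∧
    t * d ^ 2 = -2 * Real.sin (α - φ) * (1 + 2 * Real.cos (α - φ) ^ 2) := by
  have hx : Real.cos (α - φ) = a * b * c := by
    rw [Real.cos_sub, hcos, hsin, ← hS, ← hC]
    field_simp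
    linear_combination -(a * b) * hc2
  have hy : Real.sin (α - φ) = c * (a ^ 2 - b ^ 2) := by
    rw [Real.sin_sub, hcos, hsin, ← hS, ← hC]
    field_simp
    linear_combination -(a ^ 2 - b ^ 2) * hc2
  have hx' : Real.cos (φ - α) = a * b * c := by
    rw [← hx, ← Real.cos_neg, neg_sub]
  have hunit : a ^ 6 + b ^ 6 = 1 := by
    have := Real.sin_sq_add_cos_sq α
    rw [← hS, ← hC] at this
    linear_combination this
  have hx0 : 0 ≤ a * b * c := by positivity
  have hw : Real.sqrt (2 / c) ^ 2 = 2 / c := Real.sq_sqrt (by positivity)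
  have hroot (u : ℝ) : Real.sqrt (2 * (u / c) * u ^ 3) = u ^ 2 * Real.sqrt (2 / c) := by
    rw [show 2 * (u / c) * u ^ 3 = (u ^ 2) ^ 2 * (2 / c) by ring,
      Real.sqrt_mul (by positivity), Real.sqrt_sq (by positivity)]
  have hd' : d = r⁻¹ * (c ^ 2 * Real.sqrt (2 / c)) := by
    rw [hd, hcos, hsin, ← hS, ← hC, hroot, hroot, hc2]
    ring
  have hd2 : r ^ 2 * d ^ 2 = 2 * c ^ 3 := by
    rw [hd', mul_pow, mul_pow, hw]
    field_simp
  have hd0 : 0 ≤ d := by rw [hd']; positivity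
  have hs0 : 0 ≤ s := by rw [hs]; positivity
  have hs2 : s ^ 2 = r ^ 2 * (2 * a ^ 3 * b ^ 3) := by
    rw [hs, mul_pow, Real.sin_two_mul, ← hS, ← hC, Real.sq_sqrt (by positivity)]
  have hsd : s ^ 2 * d ^ 2 = 4 * (a * b * c) ^ 3 := by
    rw [hs2]
    linear_combination (2 * a ^ 3 * b ^ 3) * hd2
  have hK : Real.sqrt (2 * (a * b * c)) ^ 2 = 2 * (a * b * c) := Real.sq_sqrt (by positivity)
  rw [hx, hx', hy]
  refine ⟨hK, ?_, hsd, ?_⟩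
  · rw [← sq_eq_sq₀ (by positivity) (by positivity)]
    have h2 : Real.sqrt 2 ^ 2 = 2 := Real.sq_sqrt (by norm_num)
    rw [mul_pow, mul_pow, h2, mul_pow, hK]
    linear_combination 2 * hsd
  · rw [ht, Real.cos_two_mul', ← hS, ← hC]
    linear_combination (b ^ 6 - a ^ 6) * hd2 - 2 * c * (a ^ 2 - b ^ 2) * hunit
      - 2 * c * (a ^ 6 - b ^ 6 - 2 * (a ^ 2 - b ^ 2) * a ^ 2 * b ^ 2) * hc2

theorem B_maps_p_plus_to_p_minus
    (r₂ α₂ θ₂ s₂ t₂ c φ₂ dB : ℝ)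
    (hr₂ : 0 < r₂) (hα₂ : α₂ ∈ Set.Icc 0 (π / 2))
    (hs₂ : s₂ = r₂ * Real.sqrt (Real.sin (2 * α₂)))
    (ht₂ : t₂ = r₂ ^ 2 * Real.cos (2 * α₂))
    (hc : c = ((Real.sin α₂) ^ ((2:ℝ)/3) + (Real.cos α₂) ^ ((2:ℝ)/3)) ^ ((1:ℝ)/2))
    (hφ₂ : φ₂ ∈ Set.Icc 0 (π / 2))
    (hcos : Real.cos φ₂ = (Real.sin α₂) ^ ((1:ℝ)/3) / c)
    (hsin : Real.sin φ₂ = (Real.cos α₂) ^ ((1:ℝ)/3) / c)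
    (hdB : dB = r₂⁻¹ * (Real.sqrt (2 * Real.cos φ₂ * Real.sin α₂)
      + Real.sqrt (2 * Real.sin φ₂ * Real.cos α₂)))
    (B : GL (Fin 3) ℂ)
    (hB : (B : Matrix (Fin 3) (Fin 3) ℂ) =
      !![1, 0, 0;
         (Real.sqrt 2 : ℂ) * s₂ * Complex.exp (θ₂ * Complex.I), 1, 0;
         -(s₂ : ℂ)^2 + t₂ * Complex.I, -(Real.sqrt 2 : ℂ) * s₂ * Complex.exp (-(θ₂ * Complex.I)), 1]) :
    (B : Matrix (Fin 3) (Fin 3) ℂ).mulVec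
      ![-(dB : ℂ)^2 * Complex.exp (Complex.I * (α₂ - φ₂)),
        (dB : ℂ) * (Real.sqrt (2 * Real.cos (φ₂ - α₂)) : ℂ)
          * Complex.exp (Complex.I * (2*α₂ - 2*φ₂ + θ₂)),
        1] =
    Complex.exp (Complex.I * (2*α₂ - 2*φ₂)) •
      ![-(dB : ℂ)^2 * Complex.exp (Complex.I * (φ₂ - α₂)),
        -(dB : ℂ) * (Real.sqrt (2 * Real.cos (φ₂ - α₂)) : ℂ)
          * Complex.exp (Complex.I * (2*φ₂ - 2*α₂ + θ₂)),
        1] := by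
  have hS0 : 0 ≤ Real.sin α₂ :=
    Real.sin_nonneg_of_nonneg_of_le_pi hα₂.1 (by linarith [hα₂.2, Real.pi_pos])
  have hC0 : 0 ≤ Real.cos α₂ :=
    Real.cos_nonneg_of_neg_pi_div_two_le_of_le (by linarith [hα₂.1, Real.pi_pos]) hα₂.2
  obtain ⟨hS3, hS2⟩ := rpow_third_cube_and_sq hS0
  obtain ⟨hC3, hC2⟩ := rpow_third_cube_and_sq hC0
  have hsum : 0 < Real.sin α₂ ^ ((2:ℝ)/3) + Real.cos α₂ ^ ((2:ℝ)/3) := by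
    rcases hS0.eq_or_lt with h | h
    · have hC : Real.cos α₂ ≠ 0 := fun hC => by
        have := Real.sin_sq_add_cos_sq α₂
        rw [← h, hC] at this
        norm_num at this
      have := hC0.lt_of_ne' hC
      positivity
    · positivity
  have hc0 : 0 < c := by rw [hc]; positivity
  have hc2 : c ^ 2 = (Real.sin α₂ ^ ((1:ℝ)/3)) ^ 2 + (Real.cos α₂ ^ ((1:ℝ)/3)) ^ 2 := by
    rw [hS2, hC2, hc, ← Real.sqrt_eq_rpow, Real.sq_sqrt hsum.le]
  obtain ⟨hK, hlin, hsd, htd⟩ := real_relations hr₂ (Real.rpow_nonneg hS0 _)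
    (Real.rpow_nonneg hC0 _) hS3 hC3 hc0 hc2 hs₂ ht₂ hcos hsin hdB
  have hxy := Real.sin_sq_add_cos_sq (α₂ - φ₂)
  have hE : Complex.exp (Complex.I * (α₂ - φ₂)) =
      (Real.cos (α₂ - φ₂) : ℂ) + (Real.sin (α₂ - φ₂) : ℂ) * Complex.I := by
    rw [mul_comm, ← Complex.ofReal_sub, Complex.exp_mul_I, Complex.ofReal_cos, Complex.ofReal_sin]
  have hE' : Complex.exp (Complex.I * (φ₂ - α₂)) =
      (Real.cos (α₂ - φ₂) : ℂ) - (Real.sin (α₂ - φ₂) : ℂ) * Complex.I := by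
    rw [show Complex.I * ((φ₂ : ℂ) - α₂) = ((-(α₂ - φ₂) : ℝ) : ℂ) * Complex.I by push_cast; ring,
      Complex.exp_mul_I, ← Complex.ofReal_cos, ← Complex.ofReal_sin, Real.cos_neg, Real.sin_neg]
    push_cast
    ring
  have hdouble : Complex.exp (Complex.I * (2 * α₂ - 2 * φ₂)) =
      Complex.exp (Complex.I * (α₂ - φ₂)) ^ 2 := by
    rw [← Complex.exp_nat_mul]; congr 1; push_cast; ring
  have hplus : Complex.exp (Complex.I * (2 * α₂ - 2 * φ₂ + θ₂)) =
      Complex.exp (Complex.I * (α₂ - φ₂)) ^ 2 * Complex.exp (θ₂ * Complex.I) := by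
    rw [← hdouble, ← Complex.exp_add]; congr 1; ring
  have hminus : Complex.exp (Complex.I * (2 * φ₂ - 2 * α₂ + θ₂)) =
      Complex.exp (Complex.I * (φ₂ - α₂)) ^ 2 * Complex.exp (θ₂ * Complex.I) := by
    rw [← Complex.exp_nat_mul, ← Complex.exp_add]; congr 1; push_cast; ring
  have hT : Complex.exp (-(θ₂ * Complex.I)) * Complex.exp (θ₂ * Complex.I) = 1 := by
    rw [← Complex.exp_add]; simp
  rw [hB, hdouble, hplus, hminus, hE, hE']
  generalize Complex.exp (-(θ₂ * Complex.I)) = T' at *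
  generalize Complex.exp (θ₂ * Complex.I) = T at *
  generalize Real.cos (α₂ - φ₂) = x at *
  generalize Real.sin (α₂ - φ₂) = y at *
  generalize Real.sqrt (2 * Real.cos (φ₂ - α₂)) = K at *
  generalize Real.sqrt 2 = q at *
  have hK := congrArg (fun z : ℝ => (z : ℂ)) hK
  have hlin := congrArg (fun z : ℝ => (z : ℂ)) hlin
  have hsd := congrArg (fun z : ℝ => (z : ℂ)) hsd
  have htd := congrArg (fun z : ℝ => (z : ℂ)) htd
  have hxy := congrArg (fun z : ℝ => (z : ℂ)) hxy
  push_cast at hK hlin hsd htd hxy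
  have hI := Complex.I_sq
  have hEE : ((x : ℂ) + y * Complex.I) * (x - y * Complex.I) = 1 := by
    linear_combination hxy - y ^ 2 * hI
  ext j
  fin_cases j <;> simp [Matrix.mulVec, dotProduct, Fin.sum_univ_three]
  · linear_combination -(dB : ℂ) ^ 2 * (x + y * Complex.I) * hEE
  · linear_combination -(dB : ℂ) * T * (x + y * Complex.I) * hlin
      + (dB : ℂ) * K * T * (((x : ℂ) + y * Complex.I) * (x - y * Complex.I)) * hEE
  · linear_combination ((x : ℂ) + y * Complex.I) * hsd
      - Complex.I * (x + y * Complex.I) * htd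
      - (q : ℂ) * s₂ * dB * K * (x + y * Complex.I) ^ 2 * hT
      - (K : ℂ) * (x + y * Complex.I) ^ 2 * hlin
      - 2 * (x : ℂ) * (x + y * Complex.I) ^ 2 * hK + (y : ℂ) ^ 2 * hI - hxy
end
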